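/- arXiv:1508.03136 — 7 statements merged into one kernel-verified Lean document; each statement's English description precedes it below -/
import Mathlib

section
/- Suppose a, d ∈ ℝ^N satisfy the dynamics. If a_i ≤ a_j for two users i, j, then d_i ≤ d_j. In particular, if the arrival times are nondecreasing, a_1 ≤ a_2 ≤ … ≤ a_N, then the departure times are nondecreasing, d_1 ≤ d_2 ≤ … ≤ d_N. -/
open MeasureTheory Finset

/-- `(a, d)` satisfies the linear-slowdown processor-sharing dynamics:
every user has a positive sojourn time, and each user accumulates exactly one
unit of service at rate `β − α(q(t) − 1)`, where `q(t)` is the number of users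
present at time `t`. -/
def SlowdownDynamics (N : ℕ) (α β : ℝ) (a d : Fin N → ℝ) : Prop :=
  (∀ i, a i < d i) ∧
  ∀ i : Fin N,
    (∫ t in (a i)..(d i),
      (β - α * ((∑ j : Fin N, if t ∈ Set.Icc (a j) (d j) then (1 : ℝ) else 0) - 1))) = 1

/-- The service rate at time `t` when user `j` is present during `[a j, d j]`. -/
noncomputable def serviceRate {N : ℕ} (α β : ℝ) (a d : Fin N → ℝ) (t : ℝ) : ℝ :=
  β - α * ((∑ j : Fin N, if t ∈ Set.Icc (a j) (d j) then (1 : ℝ) else 0) - 1)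

lemma intervalIntegrable_serviceRate {N : ℕ} (α β : ℝ) (a d : Fin N → ℝ) (x y : ℝ) :
    IntervalIntegrable (serviceRate α β a d) volume x y := by
  have h_indicator (j : Fin N) :
      IntervalIntegrable (fun t => if t ∈ Set.Icc (a j) (d j) then (1 : ℝ) else 0)
        volume x y := by
    have h : Integrable ((Set.Icc (a j) (d j)).indicator fun _ : ℝ => (1 : ℝ)) volume :=
      (integrable_indicator_iff measurableSet_Icc).2 (by simp)
    exact h.intervalIntegrable.congr fun t _ => by simp [Set.indicator_apply]
  have h_sum : IntervalIntegrable
      (fun t => ∑ j : Fin N, if t ∈ Set.Icc (a j) (d j) then (1 : ℝ) else 0) volume x y := by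
    simpa only [Finset.sum_fn] using
      IntervalIntegrable.sum (s := Finset.univ) fun j _ => h_indicator j
  exact intervalIntegrable_const.sub ((h_sum.sub intervalIntegrable_const).const_mul α)

lemma le_serviceRate {N : ℕ} {α : ℝ} (hα : 0 ≤ α) (β : ℝ) (a d : Fin N → ℝ) (t : ℝ) :
    β - α * ((N : ℝ) - 1) ≤ serviceRate α β a d t := by
  have h : (∑ j : Fin N, if t ∈ Set.Icc (a j) (d j) then (1 : ℝ) else 0) ≤ N := by
    calc _ ≤ ∑ _j : Fin N, (1 : ℝ) := Finset.sum_le_sum fun j _ => by split_ifs <;> norm_num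
      _ = N := by simp
  unfold serviceRate
  gcongr

lemma mul_sub_le_integral_serviceRate {N : ℕ} {α : ℝ} (hα : 0 ≤ α) (β : ℝ) (a d : Fin N → ℝ)
    {x y : ℝ} (hxy : x ≤ y) :
    (β - α * ((N : ℝ) - 1)) * (y - x) ≤ ∫ t in x..y, serviceRate α β a d t := by
  have h := intervalIntegral.integral_mono_on hxy intervalIntegrable_const
    (intervalIntegrable_serviceRate α β a d x y) fun t _ => le_serviceRate hα β a d t
  rwa [intervalIntegral.integral_const, smul_eq_mul, mul_comm] at h

/-- If `a_i ≤ a_j` then `d_i ≤ d_j`; in particular nondecreasing arrivals give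
nondecreasing departures. -/
theorem departures_ordered_of_arrivals_ordered
    (N : ℕ) (hN : 1 ≤ N) (α β : ℝ) (hα : 0 < α) (hβ : 0 < β)
    (hstab : 0 < β - α * ((N : ℝ) - 1))
    (a d : Fin N → ℝ) (hdyn : SlowdownDynamics N α β a d) :
    (∀ i j : Fin N, a i ≤ a j → d i ≤ d j) ∧ (Monotone a → Monotone d) := by
  have h_order : ∀ i j : Fin N, a i ≤ a j → d i ≤ d j := by
    intro i j hij
    by_contra! hlt
    have h_service (k : Fin N) : ∫ t in (a k)..(d k), serviceRate α β a d t = 1 := hdyn.2 k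
    have h_int := intervalIntegrable_serviceRate α β a d
    have h_before := mul_sub_le_integral_serviceRate hα.le β a d hij
    have h_after := mul_sub_le_integral_serviceRate hα.le β a d hlt.le
    have h_left := intervalIntegral.integral_add_adjacent_intervals
      (h_int (a i) (a j)) (h_int (a j) (d j))
    have h_right := intervalIntegral.integral_add_adjacent_intervals
      (h_int (a i) (d j)) (h_int (d j) (d i))
    have h_nonneg := mul_nonneg hstab.le (sub_nonneg.2 hij)
    have h_pos := mul_pos hstab (sub_pos.2 hlt)
    linarith [h_service i, h_service j]
  exact ⟨h_order, fun ha i j hij => h_order i j (ha hij)⟩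
end

section
/- For every arrival vector a ∈ ℝ^N there exists exactly one departure vector d ∈ ℝ^N such that the pair (a, d) satisfies the dynamics. -/
open MeasureTheory Finset

/-- The integral of the indicator of one interval over another is the length of their overlap. -/
lemma integral_indicator_Icc_eq_overlap {a d : ℝ} (h : a ≤ d) (a' d' : ℝ) :
    (∫ t in a..d, if t ∈ Set.Icc a' d' then (1 : ℝ) else 0) =
      max (min d d' - max a a') 0 := by
  have hind : (fun t => if t ∈ Set.Icc a' d' then (1 : ℝ) else 0) =
      (Set.Icc a' d').indicator fun _ => 1 := by
    ext t
    simp [Set.indicator_apply]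
  rw [hind, intervalIntegral.integral_of_le h, ← integral_Icc_eq_integral_Ioc,
    setIntegral_indicator measurableSet_Icc, Set.Icc_inter_Icc, setIntegral_const,
    Real.volume_real_Icc, smul_eq_mul, mul_one]

lemma intervalIntegrable_indicator_Icc (a d a' d' : ℝ) :
    IntervalIntegrable (fun t => if t ∈ Set.Icc a' d' then (1 : ℝ) else 0) volume a d := by
  have hind : (fun t => if t ∈ Set.Icc a' d' then (1 : ℝ) else 0) =
      (Set.Icc a' d').indicator fun _ => 1 := by
    ext t
    simp [Set.indicator_apply]
  rw [hind, intervalIntegrable_iff]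
  exact (integrableOn_const (by simp [Set.uIoc])).indicator measurableSet_Icc

/-- The service received by a user, in terms of the overlaps with the other users. -/
lemma integral_service_rate {N : ℕ} (α β : ℝ) (a d : Fin N → ℝ) (i : Fin N) (h : a i ≤ d i) :
    (∫ t in (a i)..(d i),
      (β - α * ((∑ j : Fin N, if t ∈ Set.Icc (a j) (d j) then (1 : ℝ) else 0) - 1))) =
      β * (d i - a i) -
        α * ∑ j ∈ univ.erase i, max (min (d i) (d j) - max (a i) (a j)) 0 := by
  have hint : IntervalIntegrable
      (fun t => ∑ j : Fin N, if t ∈ Set.Icc (a j) (d j) then (1 : ℝ) else 0)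
      volume (a i) (d i) := by
    simpa only [Finset.sum_fn] using IntervalIntegrable.sum univ fun j _ =>
      intervalIntegrable_indicator_Icc (a i) (d i) (a j) (d j)
  rw [intervalIntegral.integral_sub intervalIntegrable_const
      ((hint.sub intervalIntegrable_const).const_mul α),
    intervalIntegral.integral_const_mul,
    intervalIntegral.integral_sub hint intervalIntegrable_const,
    intervalIntegral.integral_finsetSum fun j _ => intervalIntegrable_indicator_Icc _ _ _ _]
  simp only [integral_indicator_Icc_eq_overlap h, intervalIntegral.integral_const, smul_eq_mul]
  rw [← Finset.add_sum_erase univ _ (mem_univ i), min_self, max_self,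
    max_eq_left (sub_nonneg.2 h)]
  ring

/-- The map sending a departure vector to the one dictated by its overlaps. -/
noncomputable def departureMap {N : ℕ} (α β : ℝ) (a d : Fin N → ℝ) : Fin N → ℝ := fun i =>
  a i + (1 + α * ∑ j ∈ univ.erase i, max (min (d i) (d j) - max (a i) (a j)) 0) / β

lemma lt_departureMap {N : ℕ} {α β : ℝ} (hα : 0 < α) (hβ : 0 < β) (a d : Fin N → ℝ)
    (i : Fin N) : a i < departureMap α β a d i := by
  have : 0 ≤ ∑ j ∈ univ.erase i, max (min (d i) (d j) - max (a i) (a j)) 0 :=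
    Finset.sum_nonneg fun _ _ => le_max_right _ _
  unfold departureMap
  have : 0 < (1 + α * ∑ j ∈ univ.erase i, max (min (d i) (d j) - max (a i) (a j)) 0) / β := by
    positivity
  linarith

lemma slowdownDynamics_iff_isFixedPt {N : ℕ} {α β : ℝ} (hα : 0 < α) (hβ : 0 < β)
    (a d : Fin N → ℝ) :
    SlowdownDynamics N α β a d ↔ Function.IsFixedPt (departureMap α β a) d := by
  have key (i : Fin N) (h : a i ≤ d i) :
      (∫ t in (a i)..(d i),
        (β - α * ((∑ j : Fin N, if t ∈ Set.Icc (a j) (d j) then (1 : ℝ) else 0) - 1))) = 1 ↔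
      departureMap α β a d i = d i := by
    rw [integral_service_rate α β a d i h, departureMap, ← eq_sub_iff_add_eq',
      div_eq_iff hβ.ne']
    constructor <;> intro <;> linarith
  constructor
  · rintro ⟨hlt, hd⟩
    exact funext fun i => (key i (hlt i).le).1 (hd i)
  · intro hd
    have hlt (i : Fin N) : a i < d i :=
      (lt_departureMap hα hβ a d i).trans_eq (congrFun hd i)
    exact ⟨hlt, fun i => (key i (hlt i).le).2 (congrFun hd i)⟩

lemma abs_overlap_sub_le {N : ℕ} (a d e : Fin N → ℝ) (i j : Fin N) :
    |max (min (d i) (d j) - max (a i) (a j)) 0 - max (min (e i) (e j) - max (a i) (a j)) 0| ≤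
      dist d e := by
  refine (abs_max_sub_max_le_abs _ _ _).trans ?_
  rw [sub_sub_sub_cancel_right]
  exact (abs_min_sub_min_le_max _ _ _ _).trans
    (max_le (dist_le_pi_dist d e i) (dist_le_pi_dist d e j))

lemma dist_departureMap_le {N : ℕ} (hN : 1 ≤ N) {α β : ℝ} (hα : 0 < α) (hβ : 0 < β)
    (a d e : Fin N → ℝ) :
    dist (departureMap α β a d) (departureMap α β a e) ≤
      α * ((N : ℝ) - 1) / β * dist d e := by
  have hN' : (0 : ℝ) ≤ (N : ℝ) - 1 := sub_nonneg.2 (by exact_mod_cast hN)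
  refine (dist_pi_le_iff (by positivity)).2 fun i => ?_
  have hsum : |∑ j ∈ univ.erase i, (max (min (d i) (d j) - max (a i) (a j)) 0 -
      max (min (e i) (e j) - max (a i) (a j)) 0)| ≤ ((N : ℝ) - 1) * dist d e := by
    refine (Finset.abs_sum_le_sum_abs _ _).trans
      ((Finset.sum_le_card_nsmul _ _ _ fun j _ => abs_overlap_sub_le a d e i j).trans_eq ?_)
    rw [card_erase_of_mem (mem_univ i), card_univ, Fintype.card_fin, nsmul_eq_mul,
      Nat.cast_sub hN, Nat.cast_one]
  rw [Finset.sum_sub_distrib] at hsum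
  rw [Real.dist_eq, departureMap, departureMap, add_sub_add_left_eq_sub, ← sub_div,
    add_sub_add_left_eq_sub, ← mul_sub, abs_div, abs_mul, abs_of_pos hα, abs_of_pos hβ,
    div_mul_eq_mul_div, mul_assoc]
  gcongr

lemma contractingWith_departureMap {N : ℕ} (hN : 1 ≤ N) {α β : ℝ} (hα : 0 < α) (hβ : 0 < β)
    (hstab : 0 < β - α * ((N : ℝ) - 1)) (a : Fin N → ℝ) :
    ContractingWith (Real.toNNReal (α * ((N : ℝ) - 1) / β)) (departureMap α β a) := by
  have hN' : (0 : ℝ) ≤ (N : ℝ) - 1 := sub_nonneg.2 (by exact_mod_cast hN)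
  refine ⟨?_, LipschitzWith.of_dist_le_mul fun d e => ?_⟩
  · rw [Real.toNNReal_lt_one, div_lt_one hβ]
    linarith
  · rw [Real.coe_toNNReal _ (by positivity)]
    exact dist_departureMap_le hN hα hβ a d e

/-- For every arrival vector there is exactly one departure vector satisfying the
dynamics. -/
theorem existsUnique_departures
    (N : ℕ) (hN : 1 ≤ N) (α β : ℝ) (hα : 0 < α) (hβ : 0 < β)
    (hstab : 0 < β - α * ((N : ℝ) - 1))
    (a : Fin N → ℝ) :
    ∃! d : Fin N → ℝ, SlowdownDynamics N α β a d := by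
  have hc := contractingWith_departureMap hN hα hβ hstab a
  simp only [slowdownDynamics_iff_isFixedPt hα hβ]
  exact ⟨hc.fixedPoint, hc.fixedPoint_isFixedPt, fun _ hd => hc.fixedPoint_unique hd⟩
end

section
/- Let (a, d) satisfy the dynamics and let i < j be two users with a_i > a_j. Let ã be a with coordinates i and j exchanged and let d̃ be d with coordinates i and j exchanged. Then (ã, d̃) satisfies the dynamics, and the change in total cost equals c(ã, d̃) − c(a, d) = 2(d*_i − d*_j)(d_i − d_j), which is ≤ 0 since d*_i ≤ d*_j and d_i ≥ d_j. -/
open MeasureTheory Finset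

/-- Total cost of a schedule `(a, d)` with ideal departure times `dstar` and
sojourn-cost weight `γ`. -/
def totalCost (N : ℕ) (dstar : Fin N → ℝ) (γ : ℝ) (a d : Fin N → ℝ) : ℝ :=
  ∑ i : Fin N, ((d i - dstar i) ^ 2 + γ * (d i - a i))

lemma serviceRate_comp_equiv {N : ℕ} (α β : ℝ) (a d : Fin N → ℝ) (σ : Equiv.Perm (Fin N)) :
    serviceRate α β (a ∘ σ) (d ∘ σ) = serviceRate α β a d := by
  funext t
  unfold serviceRate
  rw [← Equiv.sum_comp σ (fun j => if t ∈ Set.Icc (a j) (d j) then (1 : ℝ) else 0)]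
  rfl

lemma serviceRate_pos {N : ℕ} {α β : ℝ} (hα : 0 < α) (hstab : 0 < β - α * ((N : ℝ) - 1))
    (a d : Fin N → ℝ) (t : ℝ) : 0 < serviceRate α β a d t := by
  have hcard : (∑ j : Fin N, if t ∈ Set.Icc (a j) (d j) then (1 : ℝ) else 0) ≤ N := by
    calc _ ≤ ∑ _j : Fin N, (1 : ℝ) := Finset.sum_le_sum fun j _ => by split_ifs <;> norm_num
      _ = N := by simp
  unfold serviceRate
  nlinarith

lemma SlowdownDynamics.comp_equiv {N : ℕ} {α β : ℝ} {a d : Fin N → ℝ}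
    (h : SlowdownDynamics N α β a d) (σ : Equiv.Perm (Fin N)) :
    SlowdownDynamics N α β (a ∘ σ) (d ∘ σ) := by
  refine ⟨fun i => h.1 (σ i), fun i => ?_⟩
  change (∫ t in (a (σ i))..(d (σ i)), serviceRate α β (a ∘ σ) (d ∘ σ) t) = 1
  rw [serviceRate_comp_equiv]
  exact h.2 (σ i)

/-- Users depart in the order in which they arrive. -/
lemma SlowdownDynamics.departure_le {N : ℕ} {α β : ℝ} (hα : 0 < α)
    (hstab : 0 < β - α * ((N : ℝ) - 1)) {a d : Fin N → ℝ}
    (h : SlowdownDynamics N α β a d) {i j : Fin N} (ha : a j < a i) : d j ≤ d i := by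
  by_contra! hd
  have hi : (∫ t in (a i)..(d i), serviceRate α β a d t) = 1 := h.2 i
  have hj : (∫ t in (a j)..(d j), serviceRate α β a d t) = 1 := h.2 j
  have hint := intervalIntegrable_serviceRate α β a d
  have hpos := serviceRate_pos hα hstab a d
  have hleft : 0 < ∫ t in (a j)..(a i), serviceRate α β a d t :=
    intervalIntegral.intervalIntegral_pos_of_pos (hint _ _) hpos ha
  have hright : 0 < ∫ t in (d i)..(d j), serviceRate α β a d t :=
    intervalIntegral.intervalIntegral_pos_of_pos (hint _ _) hpos hd
  have hsplit := intervalIntegral.integral_add_adjacent_intervals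
    (hint (a j) (a i)) (hint (a i) (d i))
  have hsplit' := intervalIntegral.integral_add_adjacent_intervals
    (hint (a j) (d i)) (hint (d i) (d j))
  linarith

lemma totalCost_comp_swap_sub {N : ℕ} (dstar : Fin N → ℝ) (γ : ℝ) (a d : Fin N → ℝ)
    {i j : Fin N} (hij : i ≠ j) :
    totalCost N dstar γ (a ∘ Equiv.swap i j) (d ∘ Equiv.swap i j) - totalCost N dstar γ a d
      = 2 * (dstar i - dstar j) * (d i - d j) := by
  unfold totalCost
  rw [← Finset.sum_sub_distrib, Fintype.sum_eq_add i j hij]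
  · simp only [Function.comp_apply, Equiv.swap_apply_left, Equiv.swap_apply_right]
    ring
  · rintro k ⟨hki, hkj⟩
    simp [Equiv.swap_apply_of_ne_of_ne hki hkj]

/-- Exchanging the arrival (and hence departure) times of an out-of-order pair of
users preserves the dynamics and changes the total cost by
`2(d*_i − d*_j)(d_i − d_j) ≤ 0`. -/
theorem swap_cost_change
    (N : ℕ) (hN : 1 ≤ N) (α β : ℝ) (hα : 0 < α) (hβ : 0 < β)
    (hstab : 0 < β - α * ((N : ℝ) - 1))
    (dstar : Fin N → ℝ) (hdstar : Monotone dstar) (γ : ℝ) (hγ : 0 ≤ γ)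
    (a d : Fin N → ℝ) (hdyn : SlowdownDynamics N α β a d)
    (i j : Fin N) (hij : i < j) (ha : a j < a i) :
    SlowdownDynamics N α β (a ∘ Equiv.swap i j) (d ∘ Equiv.swap i j) ∧
    totalCost N dstar γ (a ∘ Equiv.swap i j) (d ∘ Equiv.swap i j)
      - totalCost N dstar γ a d = 2 * (dstar i - dstar j) * (d i - d j) ∧
    totalCost N dstar γ (a ∘ Equiv.swap i j) (d ∘ Equiv.swap i j)
      - totalCost N dstar γ a d ≤ 0 := by
  have hcost := totalCost_comp_swap_sub dstar γ a d hij.ne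
  refine ⟨hdyn.comp_equiv _, hcost, ?_⟩
  rw [hcost]
  exact mul_nonpos_of_nonpos_of_nonneg (by linarith [hdstar hij.le])
    (sub_nonneg.2 (hdyn.departure_le hα hstab ha))
end

section
/- Suppose a and d are both nondecreasing and satisfy the dynamics, and let k_i and h_i be defined as stated. Then for every i ∈ {1,…,N}: (β − α(k_i − i)) d_i − α ∑_{j=h_i}^{i−1} d_j − (β − α(i − h_i)) a_i + α ∑_{j=i+1}^{k_i} a_j = 1. -/
open MeasureTheory Finset

theorem ite_mem_Icc_eq_indicator (u v : ℝ) :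
    (fun t => if t ∈ Set.Icc u v then (1 : ℝ) else 0)
      = (Set.Icc u v).indicator (fun _ => (1 : ℝ)) := by
  ext t; simp [Set.indicator]

theorem intervalIntegrable_ite_mem_Icc (u v x y : ℝ) :
    IntervalIntegrable (fun t => if t ∈ Set.Icc u v then (1 : ℝ) else 0) volume x y := by
  rw [ite_mem_Icc_eq_indicator, intervalIntegrable_iff]
  exact (integrableOn_const (by simp) (by simp)).indicator measurableSet_Icc

/-- The integral of the indicator of an interval is the length of the overlap. -/
theorem integral_ite_mem_Icc {x y : ℝ} (hxy : x ≤ y) (u v : ℝ) :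
    (∫ t in x..y, if t ∈ Set.Icc u v then (1 : ℝ) else 0) = max (min y v - max x u) 0 := by
  rw [ite_mem_Icc_eq_indicator, intervalIntegral.integral_of_le hxy, ← integral_Icc_eq_integral_Ioc,
    setIntegral_indicator measurableSet_Icc, Set.Icc_inter_Icc, setIntegral_const,
    Real.volume_real_Icc]
  simp

/-- The dynamics expressed through the overlaps of the users' sojourn intervals. -/
theorem SlowdownDynamics.sum_overlap {N : ℕ} {α β : ℝ} {a d : Fin N → ℝ}
    (hdyn : SlowdownDynamics N α β a d) (i : Fin N) :
    (β + α) * (d i - a i)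
      - α * ∑ j, max (min (d i) (d j) - max (a i) (a j)) 0 = 1 := by
  have hint := fun j => intervalIntegrable_ite_mem_Icc (a j) (d j) (a i) (d i)
  have hsum : IntervalIntegrable
      (fun t => ∑ j : Fin N, if t ∈ Set.Icc (a j) (d j) then (1 : ℝ) else 0)
      volume (a i) (d i) := by
    have h := IntervalIntegrable.sum Finset.univ (fun j _ => hint j)
    rwa [Finset.sum_fn] at h
  rw [← hdyn.2 i, intervalIntegral.integral_sub (by simp)
    ((hsum.sub (by simp)).const_mul α), intervalIntegral.integral_const_mul,
    intervalIntegral.integral_sub hsum (by simp),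
    intervalIntegral.integral_finsetSum (fun j _ => hint j)]
  simp only [integral_ite_mem_Icc (hdyn.1 i).le, intervalIntegral.integral_const, smul_eq_mul]
  ring

/-- The recursive affine form of the dynamics, where `k i` is the largest index
with `a (k i) ≤ d i` and `h i` is the smallest index with `a i ≤ d (h i)`. -/
theorem dynamics_affine_recursion
    (N : ℕ) (hN : 1 ≤ N) (α β : ℝ) (hα : 0 < α) (hβ : 0 < β)
    (hstab : 0 < β - α * ((N : ℝ) - 1))
    (a d : Fin N → ℝ) (ha : Monotone a) (hd : Monotone d)
    (hdyn : SlowdownDynamics N α β a d)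
    (k h : Fin N → Fin N)
    (hk : ∀ i : Fin N, a (k i) ≤ d i ∧ ∀ m : Fin N, a m ≤ d i → m ≤ k i)
    (hh : ∀ i : Fin N, a i ≤ d (h i) ∧ ∀ m : Fin N, a i ≤ d m → h i ≤ m) :
    ∀ i : Fin N,
      (β - α * (((k i : ℕ) : ℝ) - ((i : ℕ) : ℝ))) * d i
        - α * ∑ j ∈ Finset.Ico (h i) i, d j
        - (β - α * (((i : ℕ) : ℝ) - ((h i : ℕ) : ℝ))) * a i
        + α * ∑ j ∈ Finset.Ioc i (k i), a j = 1 := by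
  intro i
  have hmain := hdyn.sum_overlap i
  have hlt := hdyn.1
  have hhi : h i ≤ i := (hh i).2 i (hlt i).le
  have hik : i ≤ k i := (hk i).2 i (hlt i).le
  have hoverlap : ∀ j, max (min (d i) (d j) - max (a i) (a j)) 0
      = (if j ∈ Finset.Ico (h i) i then d j - a i else 0)
        + (if j ∈ Finset.Ioc i (k i) then d i - a j else 0)
        + (if j = i then d i - a i else 0) := by
    intro j
    rcases lt_trichotomy j i with hj | rfl | hj
    · rw [min_eq_right (hd hj.le), max_eq_left (ha hj.le)]
      by_cases hhj : h i ≤ j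
      · have := (hh i).1.trans (hd hhj)
        simp [hj, hhj, hj.ne, hj.not_gt, this]
      · have : d j ≤ a i := le_of_not_ge fun hc => hhj ((hh i).2 j hc)
        simp [hhj, hj.ne, hj.not_gt, this]
    · simp [(hlt j).le]
    · rw [min_eq_left (hd hj.le), max_eq_right (ha hj.le)]
      by_cases hkj : j ≤ k i
      · have := (ha hkj).trans (hk i).1
        simp [hj, hkj, hj.ne', hj.not_gt, this]
      · have : d i ≤ a j := le_of_not_ge fun hc => hkj ((hk i).2 j hc)
        simp [hkj, hj.ne', hj.not_gt, this]
  simp only [hoverlap, Finset.sum_add_distrib, Finset.sum_ite_mem, Finset.univ_inter,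
    Finset.sum_ite_eq', Finset.mem_univ, if_true, Finset.sum_sub_distrib, Finset.sum_const,
    nsmul_eq_mul, Fin.card_Ico, Fin.card_Ioc] at hmain
  rw [Nat.cast_sub (Fin.le_def.mp hhi), Nat.cast_sub (Fin.le_def.mp hik)] at hmain
  linarith
end

section
/- Suppose a and d are both nondecreasing and satisfy the dynamics, and let k_i and h_i be defined as stated. Then D d − A a = 1 (the all-ones vector), where A and D are the matrices defined from k and h as stated. -/
open MeasureTheory Finset

/-- The matrix `A`: `A i i = β − α(i − h i)`, `A i j = −α` for `i+1 ≤ j ≤ k i`,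
and `0` otherwise. -/
def matA (N : ℕ) (α β : ℝ) (k h : Fin N → Fin N) : Matrix (Fin N) (Fin N) ℝ :=
  fun i j =>
    if j = i then β - α * (((i : ℕ) : ℝ) - ((h i : ℕ) : ℝ))
    else if i < j ∧ j ≤ k i then -α else 0

/-- The matrix `D`: `D i i = β − α(k i − i)`, `D i j = −α` for `h i ≤ j ≤ i−1`,
and `0` otherwise. -/
def matD (N : ℕ) (α β : ℝ) (k h : Fin N → Fin N) : Matrix (Fin N) (Fin N) ℝ :=
  fun i j =>
    if j = i then β - α * (((k i : ℕ) : ℝ) - ((i : ℕ) : ℝ))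
    else if h i ≤ j ∧ j < i then -α else 0

/-- The length of the overlap of two intervals, as an interval integral. -/
theorem integral_Icc_ite (a d b c : ℝ) (had : a ≤ d) :
    ∫ t in a..d, (if t ∈ Set.Icc b c then (1 : ℝ) else 0) = max (min d c - max a b) 0 := by
  have heq : (fun t : ℝ => if t ∈ Set.Icc b c then (1 : ℝ) else 0) =
      (Set.Icc b c).indicator (fun _ => (1 : ℝ)) := by
    ext t
    simp only [Set.indicator_apply]
  rw [heq, intervalIntegral.integral_of_le had, ← integral_Icc_eq_integral_Ioc,
    setIntegral_indicator measurableSet_Icc, Set.Icc_inter_Icc, setIntegral_const,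
    Real.volume_real_Icc]
  simp

theorem intervalIntegrable_Icc_ite (a d b c : ℝ) :
    IntervalIntegrable (fun t => if t ∈ Set.Icc b c then (1 : ℝ) else 0) volume a d := by
  have heq : (fun t : ℝ => if t ∈ Set.Icc b c then (1 : ℝ) else 0) =
      (Set.Icc b c).indicator (fun _ => (1 : ℝ)) := by
    ext t
    simp only [Set.indicator_apply]
  rw [heq]
  have hint : Integrable ((Set.Icc b c).indicator (fun _ => (1 : ℝ))) volume :=
    (integrable_indicator_iff measurableSet_Icc).2
      (integrableOn_const (by simp))
  exact hint.intervalIntegrable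

/-- The integrated service rate over `[x, y]` in terms of overlap lengths. -/
theorem integral_slowdown_rate {ι : Type*} [Fintype ι] (α β x y : ℝ) (hxy : x ≤ y)
    (a d : ι → ℝ) :
    ∫ t in x..y, (β - α * ((∑ j, if t ∈ Set.Icc (a j) (d j) then (1 : ℝ) else 0) - 1)) =
      (β + α) * (y - x) - α * ∑ j, max (min y (d j) - max x (a j)) 0 := by
  have hsum : IntervalIntegrable
      (fun t => ∑ j, if t ∈ Set.Icc (a j) (d j) then (1 : ℝ) else 0) volume x y := by
    rw [← Finset.sum_fn]
    exact IntervalIntegrable.sum Finset.univ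
      fun j _ => intervalIntegrable_Icc_ite x y (a j) (d j)
  rw [intervalIntegral.integral_sub intervalIntegrable_const
      ((hsum.sub intervalIntegrable_const).const_mul α),
    intervalIntegral.integral_const_mul,
    intervalIntegral.integral_sub hsum intervalIntegrable_const,
    intervalIntegral.integral_finsetSum
      (fun j _ => intervalIntegrable_Icc_ite x y (a j) (d j))]
  simp only [integral_Icc_ite _ _ _ _ hxy, intervalIntegral.integral_const, smul_eq_mul]
  ring

theorem sum_ite_Ioc_one {N : ℕ} {i k : Fin N} (hik : i ≤ k) :
    (∑ j : Fin N, if i < j ∧ j ≤ k then (1 : ℝ) else 0) = ((k : ℕ) : ℝ) - ((i : ℕ) : ℝ) := by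
  have hs : (Finset.univ.filter fun j : Fin N => i < j ∧ j ≤ k) = Finset.Ioc i k := by
    ext j
    simp
  rw [Finset.sum_boole, hs, Fin.card_Ioc, Nat.cast_sub hik]

theorem sum_ite_Ico_one {N : ℕ} {h i : Fin N} (hhi : h ≤ i) :
    (∑ j : Fin N, if h ≤ j ∧ j < i then (1 : ℝ) else 0) = ((i : ℕ) : ℝ) - ((h : ℕ) : ℝ) := by
  have hs : (Finset.univ.filter fun j : Fin N => h ≤ j ∧ j < i) = Finset.Ico h i := by
    ext j
    simp
  rw [Finset.sum_boole, hs, Fin.card_Ico, Nat.cast_sub hhi]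

/-- The matrix form `D d − A a = 𝟙` of the dynamics. -/
theorem dynamics_matrix_form
    (N : ℕ) (hN : 1 ≤ N) (α β : ℝ) (hα : 0 < α) (hβ : 0 < β)
    (hstab : 0 < β - α * ((N : ℝ) - 1))
    (a d : Fin N → ℝ) (ha : Monotone a) (hd : Monotone d)
    (hdyn : SlowdownDynamics N α β a d)
    (k h : Fin N → Fin N)
    (hk : ∀ i : Fin N, a (k i) ≤ d i ∧ ∀ m : Fin N, a m ≤ d i → m ≤ k i)
    (hh : ∀ i : Fin N, a i ≤ d (h i) ∧ ∀ m : Fin N, a i ≤ d m → h i ≤ m) :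
    (matD N α β k h).mulVec d - (matA N α β k h).mulVec a = fun _ => (1 : ℝ) := by
  obtain ⟨had, hint⟩ := hdyn
  ext i
  have hik : i ≤ k i := (hk i).2 i (had i).le
  have hhi : h i ≤ i := (hh i).2 i (had i).le
  have hov : ∀ j, max (min (d i) (d j) - max (a i) (a j)) 0 =
      (if j = i then d i - a i else 0) + (if i < j ∧ j ≤ k i then d i - a j else 0) +
        (if h i ≤ j ∧ j < i then d j - a i else 0) := by
    intro j
    rcases lt_trichotomy i j with hij | rfl | hij
    · rw [min_eq_left (hd hij.le), max_eq_right (ha hij.le), if_neg hij.ne',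
        if_neg (c := h i ≤ j ∧ j < i) (fun hc => hij.not_gt hc.2), zero_add, add_zero]
      by_cases hjk : j ≤ k i
      · rw [if_pos ⟨hij, hjk⟩, max_eq_left (sub_nonneg.2 ((ha hjk).trans (hk i).1))]
      · have : d i < a j := not_le.1 fun hc => hjk ((hk i).2 j hc)
        rw [if_neg (fun hc => hjk hc.2), max_eq_right (sub_nonpos.2 this.le)]
    · simp [(had i).le]
    · rw [min_eq_right (hd hij.le), max_eq_left (ha hij.le), if_neg hij.ne,
        if_neg (c := i < j ∧ j ≤ k i) (fun hc => hij.not_gt hc.1), zero_add, zero_add]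
      by_cases hjh : h i ≤ j
      · rw [if_pos ⟨hjh, hij⟩, max_eq_left (sub_nonneg.2 ((hh i).1.trans (hd hjh)))]
      · have : d j < a i := not_le.1 fun hc => hjh ((hh i).2 j hc)
        rw [if_neg (fun hc => hjh hc.1), max_eq_right (sub_nonpos.2 this.le)]
  have hentry : ∀ j, matD N α β k h i j * d j - matA N α β k h i j * a j =
      (if j = i then (β + α) * (d i - a i) - α * (((k i : ℕ) : ℝ) - ((i : ℕ) : ℝ)) * d i +
        α * (((i : ℕ) : ℝ) - ((h i : ℕ) : ℝ)) * a i else 0) +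
      (α * d i) * (if i < j ∧ j ≤ k i then 1 else 0) -
      (α * a i) * (if h i ≤ j ∧ j < i then 1 else 0) -
      α * max (min (d i) (d j) - max (a i) (a j)) 0 := by
    intro j
    rw [hov j]
    simp only [matD, matA]
    by_cases hji : j = i
    · subst hji
      simp
      ring
    · simp only [if_neg hji]
      split_ifs <;> ring
  have hrate := hint i
  rw [integral_slowdown_rate α β _ _ (had i).le] at hrate
  simp only [Pi.sub_apply, Matrix.mulVec, dotProduct]
  rw [← Finset.sum_sub_distrib, Finset.sum_congr rfl fun j _ => hentry j,
    Finset.sum_sub_distrib, Finset.sum_sub_distrib, Finset.sum_add_distrib,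
    ← Finset.mul_sum, ← Finset.mul_sum, ← Finset.mul_sum, sum_ite_Ioc_one hik,
    sum_ite_Ico_one hhi]
  simp only [Finset.sum_ite_eq', Finset.mem_univ, if_true]
  linarith
end

section
/- For every nondecreasing vector of ideal departure times d*_1 ≤ … ≤ d*_N there exists an arrival vector a⁰ ∈ ℝ^N such that the pair (a⁰, d*) satisfies the dynamics. Consequently, when γ = 0, the schedule a⁰ attains total cost c(a⁰, d*) = 0, which is the minimum possible total cost. -/
open MeasureTheory Finset

/-- The time user `i`, arriving at `x`, overlaps with user `j`, when arrivals and departures occur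
in the order of the indices. -/
noncomputable def orderedOverlap {N : ℕ} (d a : Fin N → ℝ) (i : Fin N) (x : ℝ) (j : Fin N) : ℝ :=
  if j ≤ i then max (d j - x) 0 else max (d i - a j) 0

/-- The service received by user `i` when arriving at `x`, assuming order-preserving schedules. -/
noncomputable def orderedService {N : ℕ} (α β : ℝ) (d a : Fin N → ℝ) (i : Fin N) (x : ℝ) : ℝ :=
  (β + α) * (d i - x) - α * ∑ j, orderedOverlap d a i x j

lemma intervalIntegrable_ite_Icc (u v p q : ℝ) :
    IntervalIntegrable (fun t => if t ∈ Set.Icc p q then (1 : ℝ) else 0) volume u v := by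
  have h : (fun t => if t ∈ Set.Icc p q then (1 : ℝ) else 0)
      = (Set.Icc p q).indicator fun _ => (1 : ℝ) := by
    ext t; simp [Set.indicator_apply]
  rw [h, intervalIntegrable_iff]
  exact (integrableOn_const (by simp)).indicator measurableSet_Icc

lemma intervalIntegral_ite_Icc {u v : ℝ} (huv : u ≤ v) (p q : ℝ) :
    ∫ t in u..v, (if t ∈ Set.Icc p q then (1 : ℝ) else 0) = max (min v q - max u p) 0 := by
  have h : (fun t => if t ∈ Set.Icc p q then (1 : ℝ) else 0)
      = (Set.Icc p q).indicator fun _ => (1 : ℝ) := by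
    ext t; simp [Set.indicator_apply]
  rw [h, intervalIntegral.integral_of_le huv, ← integral_Icc_eq_integral_Ioc,
    setIntegral_indicator measurableSet_Icc, Set.Icc_inter_Icc]
  simp [Measure.real, ENNReal.toReal_ofReal']

lemma orderedService_slope {N : ℕ} {α β : ℝ} (hα : 0 < α) (d a : Fin N → ℝ) (i : Fin N)
    {x y : ℝ} (hxy : x ≤ y) :
    (β - α * ((N : ℝ) - 1)) * (y - x)
      ≤ orderedService α β d a i x - orderedService α β d a i y := by
  have h : ∑ j, (orderedOverlap d a i x j - orderedOverlap d a i y j)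
      ≤ ∑ _j : Fin N, (y - x) := by
    refine sum_le_sum fun j _ => ?_
    unfold orderedOverlap
    split_ifs
    · rcases max_cases (d j - x) 0 with h | h <;> rcases max_cases (d j - y) 0 with h' | h' <;>
        linarith
    · linarith
  rw [sum_sub_distrib, sum_const, card_univ, Fintype.card_fin, nsmul_eq_mul] at h
  have := mul_le_mul_of_nonneg_left h hα.le
  unfold orderedService
  linarith

lemma orderedService_departure_nonpos {N : ℕ} {α β : ℝ} (hα : 0 < α) (d a : Fin N → ℝ)
    (i : Fin N) : orderedService α β d a i (d i) ≤ 0 := by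
  have h : 0 ≤ ∑ j, orderedOverlap d a i (d i) j := by
    refine sum_nonneg fun j _ => ?_
    unfold orderedOverlap
    split_ifs <;> exact le_max_right _ _
  have := mul_nonneg hα.le h
  unfold orderedService
  linarith

lemma exists_orderedService_eq_one {N : ℕ} {α β : ℝ} (hα : 0 < α)
    (hstab : 0 < β - α * ((N : ℝ) - 1)) (d a : Fin N → ℝ) (i : Fin N) :
    ∃ x, orderedService α β d a i x = 1 := by
  have hc : Continuous (orderedService α β d a i) := by
    unfold orderedService
    refine (by fun_prop : Continuous fun x => (β + α) * (d i - x)).sub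
      (continuous_const.mul (continuous_finsetSum _ fun j _ => ?_))
    unfold orderedOverlap
    split_ifs <;> fun_prop
  have hd := orderedService_departure_nonpos (β := β) hα d a i
  set δ := β - α * ((N : ℝ) - 1)
  set C := 1 - orderedService α β d a i (d i) with hC
  have hC0 : 0 ≤ C := by linarith
  have hle : d i - C / δ ≤ d i := by have := div_nonneg hC0 hstab.le; linarith
  have hs := orderedService_slope (β := β) hα d a i hle
  rw [sub_sub_cancel, mul_div_cancel₀ _ hstab.ne'] at hs
  obtain ⟨x, -, hx⟩ := intermediate_value_Icc' hle hc.continuousOn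
    (show (1 : ℝ) ∈ Set.Icc _ _ from ⟨by linarith, by linarith⟩)
  exact ⟨x, hx⟩

/-- A triangular system, in which the condition of index `i` involves only the unknowns of index
at least `i`, is solvable when each condition is solvable in its own unknown. -/
lemma exists_forall_of_triangular {N : ℕ} {X : Type*} [Nonempty X]
    (P : Fin N → X → (Fin N → X) → Prop) (hex : ∀ i a, ∃ x, P i x a)
    (hcongr : ∀ i x a b, (∀ j, i < j → a j = b j) → P i x a → P i x b) :
    ∃ a : Fin N → X, ∀ i, P i (a i) a := by
  suffices h : ∀ k : ℕ, ∃ a : Fin N → X, ∀ i : Fin N, N ≤ i + k → P i (a i) a by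
    obtain ⟨a, ha⟩ := h N
    exact ⟨a, fun i => ha i (by omega)⟩
  intro k
  induction k with
  | zero => exact ⟨fun _ => Classical.arbitrary X, fun i hi => absurd i.isLt (by omega)⟩
  | succ k ih =>
    obtain ⟨a, ha⟩ := ih
    by_cases hk : k < N
    · let m : Fin N := ⟨N - (k + 1), by omega⟩
      obtain ⟨x, hx⟩ := hex m a
      refine ⟨Function.update a m x, fun i hi => ?_⟩
      rcases eq_or_ne i m with rfl | him
      · rw [Function.update_self]
        exact hcongr _ _ _ _ (fun j hj => (Function.update_of_ne hj.ne' _ _).symm) hx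
      · have hmi : m < i := by
          refine lt_of_le_of_ne ?_ him.symm
          simp only [Fin.le_def, m]
          omega
        rw [Function.update_of_ne him]
        refine hcongr _ _ _ _ (fun j hj => ?_) (ha i ?_)
        · exact (Function.update_of_ne (hmi.trans hj).ne' _ _).symm
        · simp only [Fin.lt_def, m] at hmi
          omega
    · exact ⟨a, fun i _ => ha i (by omega)⟩

lemma monotone_of_orderedService_eq_one {N : ℕ} {α β : ℝ} (hα : 0 < α)
    (hstab : 0 < β - α * ((N : ℝ) - 1)) {d a : Fin N → ℝ} (hd : Monotone d)
    (ha : ∀ i, orderedService α β d a i (a i) = 1) : Monotone a := by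
  cases N with
  | zero => exact fun i => i.elim0
  | succ n =>
    refine Fin.monotone_iff_le_succ.2 fun i => ?_
    have hdi : d i.castSucc ≤ d i.succ := hd (Fin.castSucc_lt_succ).le
    have h : ∑ j, (orderedOverlap d a i.succ (a i.succ) j
        - orderedOverlap d a i.castSucc (a i.succ) j)
        ≤ ∑ _j : Fin (n + 1), (d i.succ - d i.castSucc) := by
      refine sum_le_sum fun j _ => ?_
      have key : ∀ y, max (d i.succ - y) 0 - max (d i.castSucc - y) 0
          ≤ d i.succ - d i.castSucc := fun y => by
        rcases max_cases (d i.succ - y) 0 with h | h <;>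
          rcases max_cases (d i.castSucc - y) 0 with h' | h' <;> linarith
      unfold orderedOverlap
      rcases le_or_gt j i.castSucc with hj | hj
      · rw [if_pos hj, if_pos (hj.trans (Fin.castSucc_lt_succ).le)]
        linarith
      · rw [if_neg hj.not_ge]
        rcases (Fin.castSucc_lt_iff_succ_le.1 hj).eq_or_lt with rfl | hj'
        · rw [if_pos le_rfl]
          exact key _
        · rw [if_neg hj'.not_ge]
          exact key _
    rw [sum_sub_distrib, sum_const, card_univ, Fintype.card_fin, nsmul_eq_mul] at h
    have h1 := mul_le_mul_of_nonneg_left h hα.le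
    have h2 := ha i.succ
    have h3 := ha i.castSucc
    have h4 := mul_nonneg hstab.le (sub_nonneg.2 hdi)
    have h5 : orderedService α β d a i.castSucc (a i.succ) ≤ 1 := by
      unfold orderedService at h2 ⊢
      linarith
    by_contra! hlt
    have h6 := orderedService_slope (β := β) hα d a i.castSucc hlt.le
    have h7 := mul_pos hstab (sub_pos.2 hlt)
    linarith

lemma slowdownDynamics_of_orderedService_eq_one {N : ℕ} {α β : ℝ} (hα : 0 < α)
    (hstab : 0 < β - α * ((N : ℝ) - 1)) {d a : Fin N → ℝ} (hd : Monotone d)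
    (ha : ∀ i, orderedService α β d a i (a i) = 1) : SlowdownDynamics N α β a d := by
  have hmono := monotone_of_orderedService_eq_one hα hstab hd ha
  have hlt : ∀ i, a i < d i := fun i => by
    by_contra! hle
    have h1 := orderedService_slope (β := β) hα d a i hle
    have h2 := orderedService_departure_nonpos (β := β) hα d a i
    have h3 := mul_nonneg hstab.le (sub_nonneg.2 hle)
    linarith [ha i]
  refine ⟨hlt, fun i => ?_⟩
  have hint : ∀ j ∈ (univ : Finset (Fin N)), IntervalIntegrable
      (fun t => if t ∈ Set.Icc (a j) (d j) then (1 : ℝ) else 0) volume (a i) (d i) :=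
    fun j _ => intervalIntegrable_ite_Icc _ _ _ _
  have hsum : ∀ j, ∫ t in (a i)..(d i), (if t ∈ Set.Icc (a j) (d j) then (1 : ℝ) else 0)
      = orderedOverlap d a i (a i) j := fun j => by
    rw [intervalIntegral_ite_Icc (hlt i).le]
    unfold orderedOverlap
    split_ifs with hj
    · rw [min_eq_right (hd hj), max_eq_left (hmono hj)]
    · have hj' := (not_le.1 hj).le
      rw [min_eq_left (hd hj'), max_eq_right (hmono hj')]
  have hintsum : IntervalIntegrable
      (fun t => ∑ j : Fin N, if t ∈ Set.Icc (a j) (d j) then (1 : ℝ) else 0)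
      volume (a i) (d i) := by
    simpa only [Finset.sum_fn] using IntervalIntegrable.sum univ hint
  rw [intervalIntegral.integral_sub intervalIntegrable_const
      ((hintsum.sub intervalIntegrable_const).const_mul α),
    intervalIntegral.integral_const_mul,
    intervalIntegral.integral_sub hintsum intervalIntegrable_const,
    intervalIntegral.integral_finsetSum hint, sum_congr rfl fun j _ => hsum j,
    intervalIntegral.integral_const, intervalIntegral.integral_const]
  refine Eq.trans ?_ (ha i)
  unfold orderedService
  simp only [smul_eq_mul]
  ring

/-- There is an arrival schedule realizing the ideal departure times exactly;
with `γ = 0` it attains zero total cost, which is minimal among all feasible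
schedules. -/
theorem gamma_zero_optimal_schedule
    (N : ℕ) (hN : 1 ≤ N) (α β : ℝ) (hα : 0 < α) (hβ : 0 < β)
    (hstab : 0 < β - α * ((N : ℝ) - 1))
    (dstar : Fin N → ℝ) (hdstar : Monotone dstar) :
    ∃ a0 : Fin N → ℝ, SlowdownDynamics N α β a0 dstar ∧
      totalCost N dstar 0 a0 dstar = 0 ∧
      ∀ a d : Fin N → ℝ, SlowdownDynamics N α β a d →
        totalCost N dstar 0 a0 dstar ≤ totalCost N dstar 0 a d := by
  obtain ⟨a, ha⟩ := exists_forall_of_triangular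
    (fun i x a => orderedService α β dstar a i x = 1)
    (fun i a => exists_orderedService_eq_one hα hstab dstar a i) (by
      intro i x a b hab h
      rw [← h]
      unfold orderedService
      congr 2
      refine sum_congr rfl fun j _ => ?_
      unfold orderedOverlap
      split_ifs with hj
      · rfl
      · rw [hab j (not_le.1 hj)])
  have hzero : totalCost N dstar 0 a dstar = 0 := by simp [totalCost]
  refine ⟨a, slowdownDynamics_of_orderedService_eq_one hα hstab hdstar ha, hzero, fun b d _ => ?_⟩
  rw [hzero]
  exact sum_nonneg fun i _ => by simpa using sq_nonneg (d i - dstar i)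
end

section
/- Let α > 0 and β > 0, let r ∈ {2,…,N}, and let h, k : {1,…,r−1} → {1,…,N} satisfy h_i ≤ i ≤ k_i and β − α(k_i − i) > 0 for all i ∈ {1,…,r−1}. Define θ_1,…,θ_{r−1} recursively by: θ_i = 0 if k_i < r, and θ_i = −α(1 − ∑_{j=h_i}^{i−1} θ_j)/(β − α(k_i − i)) if k_i ≥ r. Then θ_i ≤ 0 for every i ∈ {1,…,r−1}. -/
open Finset

/-- The coefficients `θ_i` of the piecewise-affine dependence of the departure
times on a single arrival coordinate `r` are nonpositive for users arriving
before user `r`. -/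
theorem theta_coefficients_nonpositive
    (N : ℕ) (hN : 2 ≤ N) (α β : ℝ) (hα : 0 < α) (hβ : 0 < β)
    (r : ℕ) (hr : 2 ≤ r ∧ r ≤ N)
    (h k : ℕ → ℕ)
    (hhk : ∀ i ∈ Finset.Icc 1 (r - 1),
      1 ≤ h i ∧ h i ≤ i ∧ i ≤ k i ∧ k i ≤ N ∧ 0 < β - α * ((k i : ℝ) - (i : ℝ)))
    (θ : ℕ → ℝ)
    (hθ : ∀ i ∈ Finset.Icc 1 (r - 1),
      θ i = if k i < r then 0
        else -(α * (1 - ∑ j ∈ Finset.Ico (h i) i, θ j)) / (β - α * ((k i : ℝ) - (i : ℝ)))) :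
    ∀ i ∈ Finset.Icc 1 (r - 1), θ i ≤ 0 := by
  intro i
  induction i using Nat.strong_induction_on with
  | _ i ih =>
    intro hi
    obtain ⟨h_one, -, -, -, h_pos⟩ := hhk i hi
    have h_sum : ∑ j ∈ Finset.Ico (h i) i, θ j ≤ 0 := by
      refine Finset.sum_nonpos fun j hj => ?_
      rw [Finset.mem_Ico] at hj
      rw [Finset.mem_Icc] at hi
      exact ih j hj.2 (Finset.mem_Icc.2 ⟨h_one.trans hj.1, hj.2.le.trans hi.2⟩)
    rw [hθ i hi]
    split_ifs
    · exact le_rfl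
    · exact div_nonpos_of_nonpos_of_nonneg
        (neg_nonpos.2 (mul_nonneg hα.le (by linarith))) h_pos.le
end
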